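/- The set of left octonionic monogenic functions on ℝ⁸ is not a right 𝕆-module: there exist a left octonionic monogenic function f : ℝ⁸ → 𝕆 and a constant c ∈ 𝕆 such that the function x ↦ f(x)·c is not left octonionic monogenic (for example f(x) = x₁ − x₂e₄ and c = e₃). -/

import Mathlib

open Quaternion

/-- The octonions `𝕆`, realised via the Cayley–Dickson doubling of the quaternions:
`𝕆 = ℍ × ℍ` with multiplication `(a,b)(c,d) = (ac - d̄b, da + bc̄)`. -/
def Octonion : Type := ℍ[ℝ] × ℍ[ℝ]

namespace Octonion

def ofPair (x : ℍ[ℝ] × ℍ[ℝ]) : Octonion := x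
def toPair (x : Octonion) : ℍ[ℝ] × ℍ[ℝ] := x

noncomputable instance : NormedAddCommGroup Octonion :=
  inferInstanceAs (NormedAddCommGroup (ℍ[ℝ] × ℍ[ℝ]))

noncomputable instance : NormedSpace ℝ Octonion :=
  inferInstanceAs (NormedSpace ℝ (ℍ[ℝ] × ℍ[ℝ]))

noncomputable instance : One Octonion := ⟨ofPair (1, 0)⟩

/-- Cayley–Dickson multiplication `(a,b)(c,d) = (ac - d̄b, da + bc̄)`.
It is non-associative but alternative, and reproduces the standard octonion
multiplication table for the basis `e` below (`e₄ = e₁e₂`, `e₅ = e₁e₃`,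
`e₆ = e₂e₃`, `e₇ = (e₁e₂)e₃`, `eᵢ² = -1` for `i ≠ 0`, and `eᵢeⱼ = -eⱼeᵢ`
for distinct `i, j ∈ {1,…,7}`). -/
noncomputable instance : Mul Octonion :=
  ⟨fun x y => ofPair
    ((toPair x).1 * (toPair y).1 - star (toPair y).2 * (toPair x).2,
     (toPair y).2 * (toPair x).1 + (toPair x).2 * star (toPair y).1)⟩

/-- The standard basis `e₀ = 1, e₁, …, e₇` of the octonions:
`e₀ = (1,0)`, `e₁ = (i,0)`, `e₂ = (j,0)`, `e₃ = (0,1)`, `e₄ = e₁e₂ = (k,0)`,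
`e₅ = e₁e₃ = (0,i)`, `e₆ = e₂e₃ = (0,j)`, `e₇ = (e₁e₂)e₃ = (0,k)`. -/
noncomputable def e : Fin 8 → Octonion := fun i => ofPair
  (![((1 : ℍ[ℝ]), (0 : ℍ[ℝ])),
     ((⟨0,1,0,0⟩ : ℍ[ℝ]), (0 : ℍ[ℝ])),
     ((⟨0,0,1,0⟩ : ℍ[ℝ]), (0 : ℍ[ℝ])),
     ((0 : ℍ[ℝ]), (1 : ℍ[ℝ])),
     ((⟨0,0,0,1⟩ : ℍ[ℝ]), (0 : ℍ[ℝ])),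
     ((0 : ℍ[ℝ]), (⟨0,1,0,0⟩ : ℍ[ℝ])),
     ((0 : ℍ[ℝ]), (⟨0,0,1,0⟩ : ℍ[ℝ])),
     ((0 : ℍ[ℝ]), (⟨0,0,0,1⟩ : ℍ[ℝ]))] i)

end Octonion

namespace Octonion

/-- The real coordinates `x₀, …, x₇` of an octonion `x = Σᵢ xᵢ eᵢ`
with respect to the basis `e`. -/
noncomputable def coord : Fin 8 → Octonion → ℝ := fun i x =>
  ![(toPair x).1.re, (toPair x).1.imI, (toPair x).1.imJ, (toPair x).2.re,
    (toPair x).1.imK, (toPair x).2.imI, (toPair x).2.imJ, (toPair x).2.imK] i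

/-- The octonionic Cauchy–Riemann operator
`𝒟 f = ∂f/∂x₀ + Σ_{i=1}^{7} eᵢ ∂f/∂xᵢ`, the partial derivative `∂f/∂xᵢ` at `x`
being the directional derivative of `f` at `x` in the direction `eᵢ`. -/
noncomputable def CauchyRiemann (f : Octonion → Octonion) (x : Octonion) : Octonion :=
  fderiv ℝ f x (e 0) + ∑ i ∈ Finset.univ.erase (0 : Fin 8), e i * fderiv ℝ f x (e i)

/-- A function `f : ℝ⁸ ≅ 𝕆 → 𝕆` is left octonionic monogenic if `𝒟 f = 0` everywhere. -/
def LeftMonogenic (f : Octonion → Octonion) : Prop :=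
  ∀ x : Octonion, CauchyRiemann f x = 0

end Octonion

namespace Octonion

instance : FiniteDimensional ℝ Octonion :=
  inferInstanceAs (FiniteDimensional ℝ (ℍ[ℝ] × ℍ[ℝ]))

lemma mul_def (x y : Octonion) :
    x * y = ofPair ((toPair x).1 * (toPair y).1 - star (toPair y).2 * (toPair x).2,
      (toPair y).2 * (toPair x).1 + (toPair x).2 * star (toPair y).1) := rfl

@[simp] lemma toPair_ofPair (x : ℍ[ℝ] × ℍ[ℝ]) : toPair (ofPair x) = x := rfl

@[simp] lemma toPair_zero : toPair 0 = 0 := rfl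

@[simp] lemma toPair_add (x y : Octonion) : toPair (x + y) = toPair x + toPair y := rfl

@[simp] lemma toPair_smul (r : ℝ) (x : Octonion) : toPair (r • x) = r • toPair x := rfl

lemma toPair_injective : Function.Injective toPair := fun _ _ h => h

protected lemma mul_zero (x : Octonion) : x * 0 = 0 := by
  apply toPair_injective
  simp [mul_def]

protected lemma add_mul (x y z : Octonion) : (x + y) * z = x * z + y * z := by
  apply toPair_injective
  simp only [mul_def, toPair_ofPair, toPair_add, Prod.fst_add, Prod.snd_add, Prod.mk_add_mk]
  ext1 <;> simp only [add_mul, mul_add] <;> abel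

protected lemma smul_mul (r : ℝ) (x y : Octonion) : (r • x) * y = r • (x * y) := by
  apply toPair_injective
  simp [mul_def, smul_sub, smul_add]

/-- The coordinate `xᵢ` as a continuous linear functional. -/
noncomputable def coordCLM (i : Fin 8) : Octonion →L[ℝ] ℝ :=
  LinearMap.toContinuousLinearMap
    { toFun := coord i
      map_add' := fun x y => by fin_cases i <;> simp [coord]
      map_smul' := fun r x => by fin_cases i <;> simp [coord] }

lemma coordCLM_apply (i : Fin 8) (x : Octonion) : coordCLM i x = coord i x := rfl

lemma coord_add (i : Fin 8) (x y : Octonion) : coord i (x + y) = coord i x + coord i y :=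
  map_add (coordCLM i) x y

lemma coord_neg (i : Fin 8) (x : Octonion) : coord i (-x) = -coord i x :=
  map_neg (coordCLM i) x

lemma coord_zero (i : Fin 8) : coord i 0 = 0 := map_zero (coordCLM i)

lemma ext_coord {x y : Octonion} (h : ∀ i, coord i x = coord i y) : x = y := by
  apply toPair_injective
  ext
  exacts [h 0, h 1, h 2, h 4, h 3, h 5, h 6, h 7]

lemma coord_mul (i : Fin 8) (x y : Octonion) : coord i (x * y) =
    ![coord 0 x * coord 0 y - coord 1 x * coord 1 y - coord 2 x * coord 2 y - coord 3 x * coord 3 y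
        - coord 4 x * coord 4 y - coord 5 x * coord 5 y - coord 6 x * coord 6 y - coord 7 x * coord 7 y,
      coord 0 x * coord 1 y + coord 1 x * coord 0 y + coord 2 x * coord 4 y + coord 3 x * coord 5 y
        - coord 4 x * coord 2 y - coord 5 x * coord 3 y - coord 6 x * coord 7 y + coord 7 x * coord 6 y,
      coord 0 x * coord 2 y - coord 1 x * coord 4 y + coord 2 x * coord 0 y + coord 3 x * coord 6 y
        + coord 4 x * coord 1 y + coord 5 x * coord 7 y - coord 6 x * coord 3 y - coord 7 x * coord 5 y,
      coord 0 x * coord 3 y - coord 1 x * coord 5 y - coord 2 x * coord 6 y + coord 3 x * coord 0 y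
        - coord 4 x * coord 7 y + coord 5 x * coord 1 y + coord 6 x * coord 2 y + coord 7 x * coord 4 y,
      coord 0 x * coord 4 y + coord 1 x * coord 2 y - coord 2 x * coord 1 y + coord 3 x * coord 7 y
        + coord 4 x * coord 0 y - coord 5 x * coord 6 y + coord 6 x * coord 5 y - coord 7 x * coord 3 y,
      coord 0 x * coord 5 y + coord 1 x * coord 3 y - coord 2 x * coord 7 y - coord 3 x * coord 1 y
        + coord 4 x * coord 6 y + coord 5 x * coord 0 y - coord 6 x * coord 4 y + coord 7 x * coord 2 y,
      coord 0 x * coord 6 y + coord 1 x * coord 7 y + coord 2 x * coord 3 y - coord 3 x * coord 2 y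
        - coord 4 x * coord 5 y + coord 5 x * coord 4 y + coord 6 x * coord 0 y - coord 7 x * coord 1 y,
      coord 0 x * coord 7 y - coord 1 x * coord 6 y + coord 2 x * coord 5 y - coord 3 x * coord 4 y
        + coord 4 x * coord 3 y - coord 5 x * coord 2 y + coord 6 x * coord 1 y + coord 7 x * coord 0 y] i := by
  fin_cases i <;> simp [coord, mul_def] <;> ring

lemma coord_e (i j : Fin 8) : coord i (e j) = if i = j then 1 else 0 := by
  fin_cases i <;> fin_cases j <;> simp [coord, e]

/-- The Cauchy–Riemann operator applied to `x₁ a + x₂ b` is `e₁ a + e₂ b`. -/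
lemma cauchyRiemann_coord_smul (a b x : Octonion) :
    CauchyRiemann (fun y => coord 1 y • a + coord 2 y • b) x = e 1 * a + e 2 * b := by
  have h : (fun y => coord 1 y • a + coord 2 y • b) =
      ⇑((coordCLM 1).smulRight a + (coordCLM 2).smulRight b) := rfl
  have hs : Finset.univ.erase (0 : Fin 8) = {1, 2, 3, 4, 5, 6, 7} := by decide
  rw [CauchyRiemann, h, ContinuousLinearMap.fderiv, hs]
  simp [coordCLM_apply, coord_e, Octonion.mul_zero]

end Octonion

open Octonion in
/-- **Left octonionic monogenic functions on `ℝ⁸` do not form a right `𝕆`-module:**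
there exist a left octonionic monogenic `f : ℝ⁸ ≅ 𝕆 → 𝕆` and a constant `c ∈ 𝕆`
such that `x ↦ f(x)·c` is not left octonionic monogenic
(e.g. `f(x) = x₁ - x₂ e₄` and `c = e₃`). -/
theorem monogenic_not_right_module :
    ∃ (f : Octonion → Octonion) (c : Octonion),
      LeftMonogenic f ∧ ¬ LeftMonogenic (fun x : Octonion => f x * c) := by
  refine ⟨fun x => coord 1 x • e 0 + coord 2 x • (-e 4), e 3, fun x => ?_, fun h => ?_⟩
  · rw [cauchyRiemann_coord_smul]
    refine ext_coord fun i => ?_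
    fin_cases i <;> simp [coord_add, coord_mul, coord_neg, coord_zero, coord_e]
  · have h0 := h 0
    simp only [Octonion.add_mul, Octonion.smul_mul] at h0
    rw [cauchyRiemann_coord_smul] at h0
    have h5 := congrArg (coord 5) h0
    simp [coord_add, coord_mul, coord_neg, coord_zero, coord_e] at h5
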